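/- Let n, k be positive integers with k+1 coprime to n, let A ⊆ ℤ_n with |A| = k+1, and let F be a field whose characteristic does not divide n containing a primitive n-th root of unity ω. Then for every u ∈ D_{n,k} and every 0 ≤ j ≤ k, the spaces L_u and L_{T^j u} coincide (note E_u = E_{T^j u}). -/

import Mathlib

open scoped BigOperators

/-- `e(x) = ω^x` for `x ∈ ℤ_n`. -/
noncomputable def eF (n : ℕ) [NeZero n] (F : Type*) [Field F] (ω : F) (x : ZMod n) : F :=
  ω ^ x.val

/-- A function `φ : ℤ_n^k → F` is alternating: permuting the coordinates multiplies the
value by the sign of the permutation, and the value vanishes on tuples with a repeated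
coordinate. -/
def IsAlt (n : ℕ) [NeZero n] (F : Type*) [Field F] (k : ℕ)
    (φ : (Fin k → ZMod n) → F) : Prop :=
  (∀ (π : Equiv.Perm (Fin k)) (v : Fin k → ZMod n),
      φ (v ∘ π) = (Equiv.Perm.sign π : ℤ) • φ v) ∧
  (∀ v : Fin k → ZMod n, ¬ Function.Injective v → φ v = 0)

/-- The Fourier transform of `φ : ℤ_n^k → F`:
`φ̂(u) = ∑_x φ(x) e(-∑_j u_j x_j)`. -/
noncomputable def fourierT (n : ℕ) [NeZero n] (F : Type*) [Field F] (ω : F) (k : ℕ)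
    (φ : (Fin k → ZMod n) → F) : (Fin k → ZMod n) → F :=
  fun u => ∑ x : Fin k → ZMod n, φ x * eF n F ω (-(∑ j, u j * x j))

/-- Deletion of the `i`-th coordinate of a `k`-tuple (0-indexed). -/
def delCoord (n : ℕ) {k : ℕ} (i : Fin k) (v : Fin k → ZMod n) : Fin (k - 1) → ZMod n :=
  fun j =>
    if h : (j : ℕ) < (i : ℕ) then v ⟨(j : ℕ), lt_trans h i.isLt⟩
    else v ⟨(j : ℕ) + 1, by have := j.isLt; omega⟩

/-- The automorphism `T` of `ℤ_n^k`:
`T(u_1,…,u_k) = (u_2 - u_1, …, u_k - u_1, -u_1)` (0-indexed). -/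
def Ttrans (n k : ℕ) (u : Fin k → ZMod n) : Fin k → ZMod n :=
  fun i =>
    (if h : (i : ℕ) + 1 < k then u ⟨(i : ℕ) + 1, h⟩ else 0) -
      u ⟨0, Nat.lt_of_le_of_lt (Nat.zero_le _) i.isLt⟩

/-- `D_{n,k}`: the tuples in `ℤ_n^k` with all coordinates nonzero and pairwise
distinct. -/
def Dset (n k : ℕ) : Set (Fin k → ZMod n) :=
  {u | (∀ i, u i ≠ 0) ∧ Function.Injective u}

/-- `E_u = {T^i u : 0 ≤ i ≤ k}`. -/
def Eset (n k : ℕ) (u : Fin k → ZMod n) : Set (Fin k → ZMod n) :=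
  {v | ∃ i ≤ k, (Ttrans n k)^[i] u = v}

/-- The space `L_u` (realized inside the functions on all of `ℤ_n^k`; its defining
conditions only involve the values on `E_u`): the functions `g` with
`g(u) + ∑_{i=1}^k (-1)^{ki} e(-u_i a) g(T^i u) = 0` for every `a ∈ A`. -/
def Lspace (n : ℕ) [NeZero n] (F : Type*) [Field F] (ω : F) (k : ℕ)
    (A : Finset (ZMod n)) (u : Fin k → ZMod n) : Set ((Fin k → ZMod n) → F) :=
  {g | ∀ a ∈ A, g u +
      ∑ i : Fin k, (-1 : F) ^ (k * ((i : ℕ) + 1)) * eF n F ω (-(u i * a)) *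
        g ((Ttrans n k)^[(i : ℕ) + 1] u) = 0}

/-- The periodic extension of `(0, u_1, …, u_k)` to `ℕ`, with period `k + 1`. -/
def cyclicExt {n k : ℕ} (u : Fin k → ZMod n) (m : ℕ) : ZMod n :=
  if h : m % (k + 1) = 0 then 0
  else u ⟨m % (k + 1) - 1, by have := Nat.mod_lt m (Nat.add_one_pos k); omega⟩

lemma cyclicExt_zero {n k : ℕ} (u : Fin k → ZMod n) : cyclicExt u 0 = 0 := by
  simp [cyclicExt]

lemma cyclicExt_add_period {n k : ℕ} (u : Fin k → ZMod n) (m : ℕ) :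
    cyclicExt u (m + (k + 1)) = cyclicExt u m := by
  simp [cyclicExt]

lemma cyclicExt_period {n k : ℕ} (u : Fin k → ZMod n) : cyclicExt u (k + 1) = 0 := by
  simp [cyclicExt]

lemma cyclicExt_succ {n k : ℕ} (u : Fin k → ZMod n) (i : Fin k) :
    cyclicExt u ((i : ℕ) + 1) = u i := by
  have h : ((i : ℕ) + 1) % (k + 1) = (i : ℕ) + 1 := Nat.mod_eq_of_lt (by omega)
  simp [cyclicExt, h]

lemma cyclicExt_Ttrans {n k : ℕ} (u : Fin k → ZMod n) (m : ℕ) :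
    cyclicExt (Ttrans n k u) m = cyclicExt u (m + 1) - cyclicExt u 1 := by
  have hlt := Nat.mod_lt m (Nat.add_one_pos k)
  rcases Nat.eq_zero_or_pos k with rfl | hk
  · simp [cyclicExt, Nat.mod_one]
  have h1 : 1 % (k + 1) = 1 := Nat.mod_eq_of_lt (by omega)
  have hm : (m + 1) % (k + 1) = if m % (k + 1) = k then 0 else m % (k + 1) + 1 := by
    rw [Nat.add_mod, h1]
    split_ifs with h
    · simp [h]
    · exact Nat.mod_eq_of_lt (by omega)
  by_cases h0 : m % (k + 1) = 0
  · have hk' : (0 : ℕ) ≠ k := by omega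
    simp [cyclicExt, h0, hm, h1, hk']
  · by_cases h : m % (k + 1) = k
    · have hk' : ¬ (k - 1 + 1 < k) := by omega
      simp [cyclicExt, h, hm, h1, Ttrans, hk', hk.ne']
    · have hs : m % (k + 1) - 1 + 1 = m % (k + 1) := by omega
      have hlt' : m % (k + 1) < k := by omega
      simp [cyclicExt, h0, h, hm, h1, Ttrans, hs, hlt']

lemma cyclicExt_iterate_Ttrans {n k : ℕ} (u : Fin k → ZMod n) (j m : ℕ) :
    cyclicExt ((Ttrans n k)^[j] u) m = cyclicExt u (m + j) - cyclicExt u j := by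
  induction j generalizing m with
  | zero => simp [cyclicExt_zero]
  | succ j ih =>
    rw [Function.iterate_succ_apply', cyclicExt_Ttrans, ih, ih, add_right_comm, add_comm 1 j,
      add_assoc m j 1]
    ring

lemma iterate_Ttrans_period {n k : ℕ} (u : Fin k → ZMod n) :
    (Ttrans n k)^[k + 1] u = u := by
  funext i
  rw [← cyclicExt_succ ((Ttrans n k)^[k + 1] u), cyclicExt_iterate_Ttrans, cyclicExt_add_period, cyclicExt_period,
    sub_zero, cyclicExt_succ]

lemma eF_add {n : ℕ} [NeZero n] {F : Type*} [Field F] {ω : F} (hω : ω ^ n = 1)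
    (x y : ZMod n) : eF n F ω (x + y) = eF n F ω x * eF n F ω y := by
  rw [eF, eF, eF, ZMod.val_add, ← pow_add, ← pow_eq_pow_mod _ hω]

lemma eF_ne_zero {n : ℕ} [NeZero n] {F : Type*} [Field F] {ω : F} (hω : ω ^ n = 1)
    (x : ZMod n) : eF n F ω x ≠ 0 :=
  pow_ne_zero _ fun h => by simp [h, NeZero.ne n] at hω

lemma eF_zero {n : ℕ} [NeZero n] {F : Type*} [Field F] {ω : F} : eF n F ω 0 = 1 := by
  simp [eF]

lemma mem_Lspace_iff {n k : ℕ} [NeZero n] {F : Type*} [Field F] {ω : F}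
    {A : Finset (ZMod n)} {u : Fin k → ZMod n} {g : (Fin k → ZMod n) → F} :
    g ∈ Lspace n F ω k A u ↔ ∀ a ∈ A, ∑ i ∈ Finset.range (k + 1),
      (-1 : F) ^ (k * i) * eF n F ω (-(cyclicExt u i * a)) * g ((Ttrans n k)^[i] u) = 0 := by
  refine forall₂_congr fun a _ => ?_
  rw [Finset.sum_range_succ', ← Fin.sum_univ_eq_sum_range
    (fun i => (-1 : F) ^ (k * (i + 1)) * eF n F ω (-(cyclicExt u (i + 1) * a)) *
      g ((Ttrans n k)^[i + 1] u)), add_comm]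
  simp only [cyclicExt_succ, cyclicExt_zero, eF_zero, mul_zero, zero_mul, neg_zero, pow_zero,
    one_mul, Function.iterate_zero_apply]

lemma Lspace_Ttrans {n k : ℕ} [NeZero n] {F : Type*} [Field F] {ω : F} (hω : ω ^ n = 1)
    (A : Finset (ZMod n)) (u : Fin k → ZMod n) :
    Lspace n F ω k A (Ttrans n k u) = Lspace n F ω k A u := by
  ext g
  rw [mem_Lspace_iff, mem_Lspace_iff]
  refine forall₂_congr fun a _ => ?_
  set f : ℕ → F := fun i =>
    (-1 : F) ^ (k * i) * eF n F ω (-(cyclicExt u i * a)) * g ((Ttrans n k)^[i] u) with hf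
  have hper : f (k + 1) = f 0 := by
    simp only [hf, cyclicExt_period, cyclicExt_zero, iterate_Ttrans_period,
      Function.iterate_zero_apply, (Nat.even_mul_succ_self k).neg_one_pow, mul_zero, pow_zero]
  have hshift : ∑ i ∈ Finset.range (k + 1), f (i + 1) = ∑ i ∈ Finset.range (k + 1), f i := by
    rw [Finset.sum_range_succ, hper, Finset.sum_range_succ']
  have hterm : ∀ i, (-1 : F) ^ (k * i) * eF n F ω (-(cyclicExt (Ttrans n k u) i * a)) *
      g ((Ttrans n k)^[i] (Ttrans n k u)) =
      (-1) ^ k * eF n F ω (cyclicExt u 1 * a) * f (i + 1) := by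
    intro i
    have he : -(cyclicExt (Ttrans n k u) i * a) =
        cyclicExt u 1 * a + -(cyclicExt u (i + 1) * a) := by
      rw [cyclicExt_Ttrans]; ring
    have hs : (-1 : F) ^ k * (-1) ^ (k * (i + 1)) = (-1) ^ (k * i) := by
      rw [mul_add_one, pow_add, mul_left_comm, ← pow_add, (Even.add_self k).neg_one_pow, mul_one]
    simp only [he, eF_add hω, ← hs, hf, Function.iterate_succ_apply]
    ring
  have hunit : (-1 : F) ^ k * eF n F ω (cyclicExt u 1 * a) ≠ 0 :=
    mul_ne_zero (pow_ne_zero _ (neg_ne_zero.mpr one_ne_zero)) (eF_ne_zero hω _)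
  simp_rw [hterm, ← Finset.mul_sum]
  rw [hshift, mul_eq_zero, or_iff_right hunit]

lemma Eset_eq_range {n k : ℕ} (u : Fin k → ZMod n) :
    Eset n k u = Set.range fun i => (Ttrans n k)^[i] u := by
  ext v
  constructor
  · rintro ⟨i, -, rfl⟩
    exact ⟨i, rfl⟩
  · rintro ⟨i, rfl⟩
    have hper : Function.IsPeriodicPt (Ttrans n k) (k + 1) u := iterate_Ttrans_period u
    exact ⟨i % (k + 1), Nat.lt_succ_iff.mp (Nat.mod_lt i k.succ_pos), hper.iterate_mod_apply i⟩

lemma Eset_Ttrans {n k : ℕ} (u : Fin k → ZMod n) :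
    Eset n k (Ttrans n k u) = Eset n k u := by
  rw [Eset_eq_range, Eset_eq_range]
  ext v
  constructor
  · rintro ⟨i, rfl⟩
    exact ⟨i + 1, rfl⟩
  · rintro ⟨i, rfl⟩
    refine ⟨i + k, ?_⟩
    simp only
    rw [← Function.iterate_succ_apply, Nat.succ_eq_add_one, add_assoc,
      Function.iterate_add_apply, iterate_Ttrans_period]

/-- for `u ∈ D_{n,k}` and `0 ≤ j ≤ k`, the spaces `L_u` and `L_{T^j u}`
coincide (and `E_u = E_{T^j u}`). -/
theorem L_invariant_under_T (n k : ℕ) [NeZero n] (hk : 0 < k)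
    (hcop : Nat.Coprime (k + 1) n) (A : Finset (ZMod n)) (hA : A.card = k + 1)
    (F : Type*) [Field F] (hchar : ¬ (ringChar F ∣ n)) (ω : F)
    (hω : IsPrimitiveRoot ω n) (u : Fin k → ZMod n) (hu : u ∈ Dset n k)
    (j : ℕ) (hj : j ≤ k) :
    Eset n k u = Eset n k ((Ttrans n k)^[j] u) ∧
    Lspace n F ω k A u = Lspace n F ω k A ((Ttrans n k)^[j] u) := by
  constructor
  · induction j with
    | zero => rfl
    | succ j ih => rw [Function.iterate_succ_apply', Eset_Ttrans, ih (by omega)]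
  · induction j with
    | zero => rfl
    | succ j ih =>
      rw [Function.iterate_succ_apply', Lspace_Ttrans hω.pow_eq_one, ih (by omega)]
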